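/- For two samplers of the same path with connection indices b and a where 1 ≤ b < a ≤ N, the ratio of their path probability densities (per unit area) satisfies p(X_b) / p(X_a) = (D_{b-1} / D_{a-1}) · ∏_{k=b}^{a-1} (h_k / g_k) · ∏_{k=b}^{a-1} (p⁻_{k+1} / p⁺_{k-1}). -/

import Mathlib

open Finset

/-- Path probability density (per unit area) of the sampler with connection
index `a` (1 ≤ a ≤ N):
`p(X_a) = q₀ · ∏_{i=0}^{a-2} (p⁺_i g_{i+1} / D_i)
           · ∏_{i=a}^{N-1} (p⁻_{i+1} h_i / D_i) · q_N`,
where the forward-segment density is `p(x_i → x_{i+1}) = p⁺_i g_{i+1} / D_i`,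
the backward-segment density is `p(x_i ← x_{i+1}) = p⁻_{i+1} h_i / D_i`, and
empty products equal 1. -/
noncomputable def pathProbability (N : ℕ) (q₀ qN : ℝ)
    (pf pb g h D : ℕ → ℝ) (a : ℕ) : ℝ :=
  q₀ * (∏ i ∈ Finset.range (a - 1), pf i * g (i + 1) / D i)
    * (∏ i ∈ Finset.Ico a N, pb (i + 1) * h i / D i)
    * qN

/-- The path probability is positive when all of its factors are. -/
theorem pathProbability_pos (N : ℕ) {q₀ qN : ℝ} {pf pb g h D : ℕ → ℝ}
    (hq₀ : 0 < q₀) (hqN : 0 < qN)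
    (hpf : ∀ i, 0 < pf i) (hpb : ∀ i, 0 < pb i)
    (hg : ∀ i, 0 < g i) (hh : ∀ i, 0 < h i) (hD : ∀ i, 0 < D i) (a : ℕ) :
    0 < pathProbability N q₀ qN pf pb g h D a := by
  have hF : 0 < ∏ i ∈ Finset.range (a - 1), pf i * g (i + 1) / D i :=
    Finset.prod_pos fun i _ => div_pos (mul_pos (hpf i) (hg _)) (hD i)
  have hB : 0 < ∏ i ∈ Finset.Ico a N, pb (i + 1) * h i / D i :=
    Finset.prod_pos fun i _ => div_pos (mul_pos (hpb _) (hh i)) (hD i)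
  exact mul_pos (mul_pos (mul_pos hq₀ hF) hB) hqN

/-- Moving the connection index by one exchanges a forward segment for a backward one. -/
theorem pathProbability_eq_succ_mul {N : ℕ} (q₀ qN : ℝ) {pf g D : ℕ → ℝ} (pb h : ℕ → ℝ)
    (hpf : ∀ i, pf i ≠ 0) (hg : ∀ i, g i ≠ 0) (hD : ∀ i, D i ≠ 0)
    {a : ℕ} (ha : 1 ≤ a) (haN : a < N) :
    pathProbability N q₀ qN pf pb g h D a =
      pathProbability N q₀ qN pf pb g h D (a + 1) *
        (D (a - 1) / D a * (h a / g a) * (pb (a + 1) / pf (a - 1))) := by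
  obtain ⟨m, rfl⟩ := Nat.exists_eq_add_of_le' ha
  have h₁ := hpf m
  have h₂ := hg (m + 1)
  have h₃ := hD m
  have h₄ := hD (m + 1)
  simp only [pathProbability, Nat.add_sub_cancel]
  rw [Finset.prod_range_succ, Finset.prod_eq_prod_Ico_succ_bot haN]
  field_simp

/-- For two samplers of the same path with connection indices `b < a`
(`1 ≤ b`, `a ≤ N`), the ratio of path probability densities satisfies
`p(X_b) / p(X_a) = (D_{b-1} / D_{a-1}) · ∏_{k=b}^{a-1} (h_k / g_k)
                    · ∏_{k=b}^{a-1} (p⁻_{k+1} / p⁺_{k-1})`. -/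
theorem probability_ratio (N : ℕ) (hN : 2 ≤ N) (q₀ qN : ℝ)
    (pf pb g h D : ℕ → ℝ)
    (hq₀ : 0 < q₀) (hqN : 0 < qN)
    (hpf : ∀ i, 0 < pf i) (hpb : ∀ i, 0 < pb i)
    (hg : ∀ i, 0 < g i) (hh : ∀ i, 0 < h i) (hD : ∀ i, 0 < D i)
    (a b : ℕ) (hb : 1 ≤ b) (hba : b < a) (haN : a ≤ N) :
    pathProbability N q₀ qN pf pb g h D b /
        pathProbability N q₀ qN pf pb g h D a =
      (D (b - 1) / D (a - 1)) * (∏ k ∈ Finset.Ico b a, h k / g k)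
        * (∏ k ∈ Finset.Ico b a, pb (k + 1) / pf (k - 1)) := by
  rw [div_eq_iff (pathProbability_pos N hq₀ hqN hpf hpb hg hh hD a).ne']
  induction a, hba.le using Nat.le_induction with
  | base => exact absurd hba (lt_irrefl b)
  | succ a hab ih =>
    have step := pathProbability_eq_succ_mul q₀ qN pb h (fun i => (hpf i).ne')
      (fun i => (hg i).ne') (fun i => (hD i).ne') (hb.trans hab) haN
    rw [Finset.prod_Ico_succ_top hab, Finset.prod_Ico_succ_top hab, Nat.add_sub_cancel]
    rcases hab.eq_or_lt with rfl | hlt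
    · rw [step]
      simp only [Finset.Ico_self, Finset.prod_empty, one_mul]
      ring
    · rw [ih hlt (Nat.le_of_succ_le haN), step,
        ← div_mul_div_cancel₀ (a := D (b - 1)) (c := D a) (hD (a - 1)).ne']
      generalize pathProbability N q₀ qN pf pb g h D (a + 1) = P
      ring
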